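/- arXiv:2005.07166 — 2 statements merged into one kernel-verified Lean document; each statement's English description precedes it below -/
import Mathlib

section
/- Weak positivity of the high-order 1D well-balanced DG scheme (Theorem 3.3): let h, Δt > 0, let L ≥ 2 and N ≥ 1 be integers, let ω̂₁, …, ω̂_L > 0 with Σ_ν ω̂_ν = 1 and ω̂₁ = ω̂_L, and let ω₁, …, ω_N > 0 with Σ_μ ω_μ = 1. Suppose given admissible states: exterior interface traces U⁻_{j−1/2}, U⁺_{j+1/2} ∈ G; Gauss–Lobatto point values V₁, …, V_L ∈ G, with interior traces U⁺_{j−1/2} := V₁ and U⁻_{j+1/2} := V_L; and Gauss point values W₁, …, W_N ∈ G; such that the cell average Ū := Σ_ν ω̂_ν V_ν = (ρ̄, m̄, Ē) also satisfies Ū = Σ_μ ω_μ W_μ, and set ē = (Ē − m̄²/(2ρ̄))/ρ̄. Suppose also given equilibrium data: ρ^e_μ > 0, p^e_μ > 0, d_μ ∈ ℝ for μ = 1, …, N (values of ρ^e_h, p^e_h and of the derivative (p^e_h)_x at the Gauss points), interface traces p^{e,−}_{j−1/2}, p^{e,+}_{j−1/2}, p^{e,−}_{j+1/2}, p^{e,+}_{j+1/2}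 > 0, and ρ̄^e > 0, satisfying the quadrature-exactness identity h·Σ_μ ω_μ d_μ = p^{e,−}_{j+1/2} − p^{e,+}_{j−1/2}. Set p^{e,⋆}_{j+1/2} = (p^{e,−}_{j+1/2} + p^{e,+}_{j+1/2})/2, p^{e,⋆}_{j−1/2} = (p^{e,−}_{j−1/2} + p^{e,+}_{j−1/2})/2, and jumps ⟦p^e⟧_{j±1/2} = p^{e,+}_{j±1/2} − p^{e,−}_{j±1/2}. Define the fluxes F̂_{j+1/2} = F^hllc((p^{e,⋆}_{j+1/2}/p^{e,−}_{j+1/2}) U⁻_{j+1/2}, (p^{e,⋆}_{j+1/2}/p^{e,+}_{j+1/2}) U⁺_{j+1/2}) and F̂_{j−1/2} = F^hllc((p^{e,⋆}_{j−1/2}/p^{e,−}_{j−1/2}) U⁻_{j−1/2}, (p^{e,⋆}_{j−1/2}/p^{e,+}_{j−1/2}) U⁺_{j−1/2}), and the discretized source S̄ = (0, S̄², S̄³) with S̄² = Σ_μ ω_μ (ρ(W_μ)/ρ^e_μ − ρ̄/ρ̄^e) d_μ + (ρ̄/(ρ̄^e h))(p^{e,⋆}_{j+1/2} − p^{e,⋆}_{j−1/2})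 and S̄³ = Σ_μ ω_μ (m(W_μ)/ρ^e_μ − m̄/ρ̄^e) d_μ + (m̄/(ρ̄^e h))(p^{e,⋆}_{j+1/2} − p^{e,⋆}_{j−1/2}), where ρ(W) and m(W) denote the first and second components of W. Define α̃^F = 2·max{p^{e,⋆}_{j+1/2}/p^{e,−}_{j+1/2}, p^{e,⋆}_{j−1/2}/p^{e,+}_{j−1/2}}·max{α_max(U) : U ∈ {U⁻_{j−1/2}, U⁺_{j−1/2}, U⁻_{j+1/2}, U⁺_{j+1/2}}}, α̃^S = ω̂₁ h · max_{1≤μ≤N} |d_μ|/(ρ^e_μ √(2e(W_μ))) where e(W) is the specific internal energy of W, and ᾱ^S = ω̂₁ |⟦p^e⟧_{j+1/2} + ⟦p^e⟧_{j−1/2}|/(2 ρ̄^e √(2ē)). If Δt·(α̃^F + α̃^S + ᾱ^S) ≤ ω̂₁ h, then Ū − (Δt/h)(F̂_{j+1/2} − F̂_{j−1/2}) + Δt·S̄ ∈ G. -/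
noncomputable section

/-- A 1D state `U = (ρ, m, E)`. -/
abbrev St : Type := ℝ × ℝ × ℝ

/-- The admissible set `G = {(ρ, m, E) : ρ > 0, E − m²/(2ρ) > 0}`. -/
def admG : Set St := {U | 0 < U.1 ∧ 0 < U.2.2 - U.2.1 ^ 2 / (2 * U.1)}

/-- The velocity `u = m/ρ`. -/
def vel (U : St) : ℝ := U.2.1 / U.1

/-- The pressure `p = (γ−1)(E − m²/(2ρ))`. -/
def press (γ : ℝ) (U : St) : ℝ := (γ - 1) * (U.2.2 - U.2.1 ^ 2 / (2 * U.1))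

/-- The sound speed `√(γ p / ρ)`. -/
def sound (γ : ℝ) (U : St) : ℝ := Real.sqrt (γ * press γ U / U.1)

/-- The specific internal energy `e = (E − m²/(2ρ))/ρ`. -/
def specE (U : St) : ℝ := (U.2.2 - U.2.1 ^ 2 / (2 * U.1)) / U.1

/-- The Euler flux `F(U) = (ρu, ρu² + p, (E+p)u)`. -/
def eulerF (γ : ℝ) (U : St) : St :=
  (U.1 * vel U, U.1 * vel U ^ 2 + press γ U, (U.2.2 + press γ U) * vel U)

/-- `α₋(U) = u − √(γp/ρ)`. -/
def alphaMinus (γ : ℝ) (U : St) : ℝ := vel U - sound γ U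

/-- `α₊(U) = u + √(γp/ρ)`. -/
def alphaPlus (γ : ℝ) (U : St) : ℝ := vel U + sound γ U

/-- `α_max(U) = |u| + √(γp/ρ)`. -/
def alphaMax (γ : ℝ) (U : St) : ℝ := |vel U| + sound γ U

/-- Left wave speed `S_L = min(α₋(U_L), α₋(U_R))`. -/
def SL (γ : ℝ) (UL UR : St) : ℝ := min (alphaMinus γ UL) (alphaMinus γ UR)

/-- Right wave speed `S_R = max(α₊(U_L), α₊(U_R))`. -/
def SR (γ : ℝ) (UL UR : St) : ℝ := max (alphaPlus γ UL) (alphaPlus γ UR)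

/-- Middle wave speed `S_*`. -/
def Sstar (γ : ℝ) (UL UR : St) : ℝ :=
  (press γ UR - press γ UL + UL.1 * vel UL * (SL γ UL UR - vel UL)
      - UR.1 * vel UR * (SR γ UL UR - vel UR)) /
    (UL.1 * (SL γ UL UR - vel UL) - UR.1 * (SR γ UL UR - vel UR))

/-- HLLC intermediate state
`U_{*i} = ρ_i (S_i − u_i)/(S_i − S_*) · (1, S_*, E_i/ρ_i + (S_* − u_i)(S_* + p_i/(ρ_i(S_i − u_i))))`. -/
def Ustar (γ : ℝ) (Si Sst : ℝ) (Ui : St) : St :=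
  (Ui.1 * ((Si - vel Ui) / (Si - Sst))) •
    (((1 : ℝ), Sst,
      Ui.2.2 / Ui.1 + (Sst - vel Ui) * (Sst + press γ Ui / (Ui.1 * (Si - vel Ui)))) : St)

/-- Intermediate flux `F_{*i} = F(U_i) + S_i (U_{*i} − U_i)`. -/
def Fstar (γ : ℝ) (Si Sst : ℝ) (Ui : St) : St :=
  eulerF γ Ui + Si • (Ustar γ Si Sst Ui - Ui)

/-- The HLLC numerical flux. -/
def Fhllc (γ : ℝ) (UL UR : St) : St :=
  if 0 ≤ SL γ UL UR then eulerF γ UL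
  else if 0 ≤ Sstar γ UL UR then Fstar γ (SL γ UL UR) (Sstar γ UL UR) UL
  else if 0 ≤ SR γ UL UR then Fstar γ (SR γ UL UR) (Sstar γ UL UR) UR
  else eulerF γ UR

end

theorem rho_mul_vel {U : St} (hU : U ∈ admG) : U.1 * vel U = U.2.1 := by
  have := hU.1.ne'
  unfold vel
  field_simp

theorem press_pos {γ : ℝ} (hγ : 1 < γ) {U : St} (hU : U ∈ admG) : 0 < press γ U :=
  mul_pos (by linarith) hU.2

theorem sound_pos {γ : ℝ} (hγ : 1 < γ) {U : St} (hU : U ∈ admG) : 0 < sound γ U :=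
  Real.sqrt_pos.mpr (div_pos (mul_pos (by linarith) (press_pos hγ hU)) hU.1)

theorem alphaMax_pos {γ : ℝ} (hγ : 1 < γ) {U : St} (hU : U ∈ admG) : 0 < alphaMax γ U :=
  add_pos_of_nonneg_of_pos (abs_nonneg _) (sound_pos hγ hU)

theorem rho_mul_sound_sq {γ : ℝ} (hγ : 1 < γ) {U : St} (hU : U ∈ admG) :
    U.1 * sound γ U ^ 2 = γ * press γ U := by
  have h1 := hU.1
  have h2 := press_pos hγ hU
  unfold sound
  rw [Real.sq_sqrt (by positivity)]
  field_simp

theorem vel_smul {r : ℝ} (hr : 0 < r) (U : St) : vel (r • U) = vel U := by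
  simp only [vel, Prod.smul_fst, Prod.smul_snd, smul_eq_mul]
  exact mul_div_mul_left _ _ hr.ne'

theorem press_smul (γ : ℝ) {r : ℝ} (hr : 0 < r) (U : St) :
    press γ (r • U) = r * press γ U := by
  simp only [press, Prod.smul_fst, Prod.smul_snd, smul_eq_mul]
  have : (r * U.2.1) ^ 2 / (2 * (r * U.1)) = r * (U.2.1 ^ 2 / (2 * U.1)) := by
    rw [show (r * U.2.1) ^ 2 = r * (r * U.2.1 ^ 2) by ring,
      show 2 * (r * U.1) = r * (2 * U.1) by ring, mul_div_mul_left _ _ hr.ne', mul_div_assoc]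
  rw [this]
  ring

theorem alphaMax_smul (γ : ℝ) {r : ℝ} (hr : 0 < r) (U : St) :
    alphaMax γ (r • U) = alphaMax γ U := by
  simp only [alphaMax, sound, vel_smul hr, press_smul γ hr, Prod.smul_fst, smul_eq_mul]
  rw [show γ * (r * press γ U) = r * (γ * press γ U) by ring, mul_div_mul_left _ _ hr.ne']

theorem smul_mem_admG {r : ℝ} (hr : 0 < r) {U : St} (hU : U ∈ admG) : r • U ∈ admG := by
  have h := press_smul 2 hr U
  simp only [press] at h
  refine ⟨mul_pos hr hU.1, ?_⟩
  have := mul_pos hr hU.2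
  linarith

/-- The linear functional `U ↦ E − v m + v² ρ / 2`; for `ρ > 0` its minimum over `v` is the
internal energy `E − m² / (2ρ)`. -/
noncomputable def energyFunctional (v : ℝ) : St →ₗ[ℝ] ℝ where
  toFun U := U.2.2 - v * U.2.1 + v ^ 2 / 2 * U.1
  map_add' U W := by simp; ring
  map_smul' r U := by simp; ring

theorem energyFunctional_apply (v : ℝ) (U : St) :
    energyFunctional v U = U.2.2 - v * U.2.1 + v ^ 2 / 2 * U.1 := rfl

theorem energyFunctional_eq (v : ℝ) {U : St} (hU : U ∈ admG) :
    energyFunctional v U = U.1 * (specE U + (vel U - v) ^ 2 / 2) := by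
  have := hU.1.ne'
  rw [energyFunctional_apply]
  unfold specE vel
  field_simp
  ring

theorem specE_pos {U : St} (hU : U ∈ admG) : 0 < specE U := div_pos hU.2 hU.1

theorem energyFunctional_pos (v : ℝ) {U : St} (hU : U ∈ admG) : 0 < energyFunctional v U := by
  rw [energyFunctional_eq v hU]
  have := specE_pos hU
  have := hU.1
  positivity

theorem mem_admG_of_energyFunctional_pos {U : St} (h1 : 0 < U.1)
    (h2 : ∀ v, 0 < energyFunctional v U) : U ∈ admG := by
  refine ⟨h1, ?_⟩
  have h := h2 (vel U)
  rw [energyFunctional_apply] at h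
  convert h using 1
  unfold vel
  field_simp
  ring

/-- The momentum–energy direction `(0, ρ, m)` of a source term. -/
noncomputable def sourceDir : St →ₗ[ℝ] St where
  toFun U := (0, U.1, U.2.1)
  map_add' U W := by simp
  map_smul' r U := by simp

theorem sourceDir_apply (U : St) : sourceDir U = (0, U.1, U.2.1) := rfl

theorem energyFunctional_add_source_nonneg (v : ℝ) {U : St} (hU : U ∈ admG) {c t : ℝ}
    (ht : |t| ≤ c * Real.sqrt (2 * specE U)) :
    0 ≤ c * energyFunctional v U + t * energyFunctional v (sourceDir U) := by
  have he := specE_pos hU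
  have h1 := hU.1
  have hsq : Real.sqrt (2 * specE U) ^ 2 = 2 * specE U := Real.sq_sqrt (by positivity)
  have hs : energyFunctional v (sourceDir U) = U.1 * (vel U - v) := by
    rw [energyFunctional_apply, sourceDir_apply, mul_sub, rho_mul_vel hU]
    ring
  have hc : 0 ≤ c :=
    nonneg_of_mul_nonneg_left ((abs_nonneg t).trans ht) (Real.sqrt_pos.mpr (by positivity))
  have hle : -(t * (vel U - v)) ≤ c * (specE U + (vel U - v) ^ 2 / 2) := by
    calc -(t * (vel U - v)) ≤ |t| * |vel U - v| := by
          rw [← abs_mul]; exact neg_le_abs _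
      _ ≤ c * Real.sqrt (2 * specE U) * |vel U - v| := by gcongr
      _ = c * (Real.sqrt (2 * specE U) * |vel U - v|) := by ring
      _ ≤ c * (specE U + (vel U - v) ^ 2 / 2) := by
          gcongr
          nlinarith [sq_nonneg (Real.sqrt (2 * specE U) - |vel U - v|), sq_abs (vel U - v)]
  have := mul_nonneg h1.le (neg_le_iff_add_nonneg.mp hle)
  rw [energyFunctional_eq v hU, hs]
  linarith

section Cone

variable {γ : ℝ}

theorem specE_eq {U : St} (hγ : 1 < γ) (hU : U ∈ admG) :
    specE U = press γ U / ((γ - 1) * U.1) := by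
  have := hU.1.ne'
  have : γ - 1 ≠ 0 := by linarith
  unfold specE press
  field_simp

/-- The wave-speed bound that makes the internal energies of all the intermediate states
positive. -/
theorem press_sq_div_lt_specE (hγ : 1 < γ) {U : St} (hU : U ∈ admG) {w : ℝ}
    (hw : sound γ U ^ 2 ≤ w ^ 2) :
    (press γ U / (U.1 * w)) ^ 2 / 2 < specE U := by
  have h1 := hU.1
  have h2 := press_pos hγ hU
  have h3 := rho_mul_sound_sq hγ hU
  have h4 := sound_pos hγ hU
  have hw2 : 0 < w ^ 2 := lt_of_lt_of_le (by positivity) hw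
  have h5 : γ * press γ U ≤ U.1 * w ^ 2 := by rw [← h3]; gcongr
  have hγ1 : 0 < γ - 1 := by linarith
  rw [specE_eq hγ hU, div_pow, mul_pow, div_div, div_lt_div_iff₀ (by positivity) (by positivity)]
  have h6 : (γ - 1) * press γ U < U.1 * w ^ 2 * 2 := by nlinarith
  have := mul_lt_mul_of_pos_left h6 (mul_pos h2 h1)
  nlinarith

theorem Ustar_mem_admG (hγ : 1 < γ) {U : St} (hU : U ∈ admG) {S s : ℝ}
    (hpos : 0 < (S - vel U) / (S - s)) (hw : sound γ U ^ 2 ≤ (S - vel U) ^ 2) :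
    Ustar γ S s U ∈ admG := by
  have h1 := hU.1
  have hp := press_sq_div_lt_specE hγ hU hw
  have he : U.2.2 / U.1 = specE U + vel U ^ 2 / 2 := by
    unfold specE vel
    field_simp
    ring
  refine smul_mem_admG (mul_pos h1 hpos) ⟨one_pos, ?_⟩
  simp only [he, mul_one]
  nlinarith [sq_nonneg (s - vel U + press γ U / (U.1 * (S - vel U)))]

theorem sub_eulerF_mem_admG (hγ : 1 < γ) {U : St} (hU : U ∈ admG) {a : ℝ}
    (ha : alphaMax γ U ≤ a) : a • U - eulerF γ U ∈ admG := by
  have h1 := hU.1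
  have hc := sound_pos hγ hU
  have hw : sound γ U ≤ a - vel U := by
    have := le_abs_self (vel U)
    unfold alphaMax at ha
    linarith
  have hw0 : 0 < a - vel U := hc.trans_le hw
  have hp := press_sq_div_lt_specE hγ hU (pow_le_pow_left₀ hc.le hw 2)
  have hm := rho_mul_vel hU
  have hE : U.2.2 = U.1 * (specE U + vel U ^ 2 / 2) := by
    unfold specE vel
    field_simp
    ring
  have hrw : a • U - eulerF γ U = (U.1 * (a - vel U)) •
      ((1 : ℝ), vel U - press γ U / (U.1 * (a - vel U)),
        specE U + vel U ^ 2 / 2 - vel U * (press γ U / (U.1 * (a - vel U)))) := by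
    refine Prod.ext ?_ (Prod.ext ?_ ?_)
    · simp [eulerF]; ring
    · simp only [eulerF, Prod.snd_sub, Prod.fst_sub, Prod.smul_snd, Prod.smul_fst, smul_eq_mul,
        ← hm]
      field_simp
      ring
    · simp only [eulerF, Prod.snd_sub, Prod.smul_snd, smul_eq_mul, hE]
      field_simp
      ring
  rw [hrw]
  refine smul_mem_admG (mul_pos h1 hw0) ⟨one_pos, ?_⟩
  simp only [mul_one]
  nlinarith

theorem add_eulerF_mem_admG (hγ : 1 < γ) {U : St} (hU : U ∈ admG) {a : ℝ}
    (ha : alphaMax γ U ≤ a) : a • U + eulerF γ U ∈ admG := by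
  have h1 := hU.1
  have hc := sound_pos hγ hU
  have hw : sound γ U ≤ a + vel U := by
    have := neg_abs_le (vel U)
    unfold alphaMax at ha
    linarith
  have hw0 : 0 < a + vel U := hc.trans_le hw
  have hp := press_sq_div_lt_specE hγ hU (pow_le_pow_left₀ hc.le hw 2)
  have hm := rho_mul_vel hU
  have hE : U.2.2 = U.1 * (specE U + vel U ^ 2 / 2) := by
    unfold specE vel
    field_simp
    ring
  have hrw : a • U + eulerF γ U = (U.1 * (a + vel U)) •
      ((1 : ℝ), vel U + press γ U / (U.1 * (a + vel U)),
        specE U + vel U ^ 2 / 2 + vel U * (press γ U / (U.1 * (a + vel U)))) := by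
    refine Prod.ext ?_ (Prod.ext ?_ ?_)
    · simp [eulerF]; ring
    · simp only [eulerF, Prod.snd_add, Prod.fst_add, Prod.smul_snd, Prod.smul_fst, smul_eq_mul,
        ← hm]
      field_simp
      ring
    · simp only [eulerF, Prod.snd_add, Prod.smul_snd, smul_eq_mul, hE]
      field_simp
      ring
  rw [hrw]
  refine smul_mem_admG (mul_pos h1 hw0) ⟨one_pos, ?_⟩
  simp only [mul_one]
  nlinarith

theorem Fstar_eq {U : St} (hU : U ∈ admG) {S s : ℝ} (hS : S - s ≠ 0)
    (hw : S - vel U ≠ 0) :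
    Fstar γ S s U = s • Ustar γ S s U +
      ((0 : ℝ), press γ U + U.1 * (S - vel U) * (s - vel U),
        (press γ U + U.1 * (S - vel U) * (s - vel U)) * s) := by
  have h1 := hU.1.ne'
  have hm := rho_mul_vel hU
  refine Prod.ext ?_ (Prod.ext ?_ ?_)
  · simp only [Fstar, Ustar, eulerF, Prod.fst_add, Prod.fst_sub, Prod.smul_fst, smul_eq_mul]
    field_simp
    ring
  · simp only [Fstar, Ustar, eulerF, Prod.fst_add, Prod.fst_sub, Prod.smul_fst, Prod.snd_add,
      Prod.snd_sub, Prod.smul_snd, smul_eq_mul, ← hm]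
    field_simp
    ring
  · simp only [Fstar, Ustar, eulerF, Prod.snd_add, Prod.snd_sub, Prod.smul_snd, smul_eq_mul]
    field_simp
    ring

variable {UL UR : St}

theorem SL_sub_vel_left_le : SL γ UL UR - vel UL ≤ -sound γ UL := by
  have : SL γ UL UR ≤ alphaMinus γ UL := min_le_left _ _
  unfold alphaMinus at this
  linarith

theorem SL_sub_vel_right_le : SL γ UL UR - vel UR ≤ -sound γ UR := by
  have : SL γ UL UR ≤ alphaMinus γ UR := min_le_right _ _
  unfold alphaMinus at this
  linarith

theorem le_SR_sub_vel_left : sound γ UL ≤ SR γ UL UR - vel UL := by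
  have : alphaPlus γ UL ≤ SR γ UL UR := le_max_left _ _
  unfold alphaPlus at this
  linarith

theorem le_SR_sub_vel_right : sound γ UR ≤ SR γ UL UR - vel UR := by
  have : alphaPlus γ UR ≤ SR γ UL UR := le_max_right _ _
  unfold alphaPlus at this
  linarith

theorem Sstar_denom_neg (hγ : 1 < γ) (hL : UL ∈ admG) (hR : UR ∈ admG) :
    UL.1 * (SL γ UL UR - vel UL) - UR.1 * (SR γ UL UR - vel UR) < 0 := by
  have hcL := sound_pos hγ hL
  have hcR := sound_pos hγ hR
  have h1 : SL γ UL UR - vel UL < 0 := by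
    linarith [SL_sub_vel_left_le (γ := γ) (UL := UL) (UR := UR)]
  have h2 : 0 < SR γ UL UR - vel UR := by
    linarith [le_SR_sub_vel_right (γ := γ) (UL := UL) (UR := UR)]
  linarith [mul_neg_of_pos_of_neg hL.1 h1, mul_pos hR.1 h2]

theorem press_lt_rho_mul (hγ : 1 < γ) {U : St} (hU : U ∈ admG) {a b : ℝ}
    (ha : sound γ U ≤ a) (hb : sound γ U ≤ b) : press γ U < U.1 * (a * b) := by
  have hc := sound_pos hγ hU
  have h3 := rho_mul_sound_sq hγ hU
  have hp := press_pos hγ hU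
  have h1 : sound γ U * sound γ U ≤ a * b := mul_le_mul ha hb hc.le (hc.le.trans ha)
  have := mul_le_mul_of_nonneg_left h1 hU.1.le
  nlinarith

theorem SL_lt_Sstar (hγ : 1 < γ) (hL : UL ∈ admG) (hR : UR ∈ admG) :
    SL γ UL UR < Sstar γ UL UR := by
  unfold Sstar
  rw [lt_div_iff_of_neg (Sstar_denom_neg hγ hL hR)]
  have h1 := press_lt_rho_mul hγ hR (le_SR_sub_vel_right (γ := γ) (UL := UL) (UR := UR))
    (le_neg_of_le_neg (SL_sub_vel_right_le (γ := γ) (UL := UL) (UR := UR)))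
  have h2 := press_pos hγ hL
  have h3 := mul_nonneg hL.1.le (sq_nonneg (SL γ UL UR - vel UL))
  nlinarith

theorem Sstar_lt_SR (hγ : 1 < γ) (hL : UL ∈ admG) (hR : UR ∈ admG) :
    Sstar γ UL UR < SR γ UL UR := by
  unfold Sstar
  rw [div_lt_iff_of_neg (Sstar_denom_neg hγ hL hR)]
  have h1 := press_lt_rho_mul hγ hL (le_SR_sub_vel_left (γ := γ) (UL := UL) (UR := UR))
    (le_neg_of_le_neg (SL_sub_vel_left_le (γ := γ) (UL := UL) (UR := UR)))
  have h2 := press_pos hγ hR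
  have h3 := mul_nonneg hR.1.le (sq_nonneg (SR γ UL UR - vel UR))
  nlinarith

theorem Ustar_left_mem_admG (hγ : 1 < γ) (hL : UL ∈ admG) (hR : UR ∈ admG) :
    Ustar γ (SL γ UL UR) (Sstar γ UL UR) UL ∈ admG := by
  have hc := sound_pos hγ hL
  have h := SL_sub_vel_left_le (γ := γ) (UL := UL) (UR := UR)
  refine Ustar_mem_admG hγ hL
    (div_pos_of_neg_of_neg (by linarith) (sub_neg.mpr (SL_lt_Sstar hγ hL hR))) ?_
  nlinarith

theorem Ustar_right_mem_admG (hγ : 1 < γ) (hL : UL ∈ admG) (hR : UR ∈ admG) :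
    Ustar γ (SR γ UL UR) (Sstar γ UL UR) UR ∈ admG := by
  have hc := sound_pos hγ hR
  have h := le_SR_sub_vel_right (γ := γ) (UL := UL) (UR := UR)
  refine Ustar_mem_admG hγ hR
    (div_pos (by linarith) (sub_pos.mpr (Sstar_lt_SR hγ hL hR))) ?_
  nlinarith

/-- The Rankine–Hugoniot relation across the contact wave. -/
theorem Fstar_right_sub_left (hγ : 1 < γ) (hL : UL ∈ admG) (hR : UR ∈ admG) :
    Fstar γ (SR γ UL UR) (Sstar γ UL UR) UR - Fstar γ (SL γ UL UR) (Sstar γ UL UR) UL =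
      Sstar γ UL UR • (Ustar γ (SR γ UL UR) (Sstar γ UL UR) UR -
        Ustar γ (SL γ UL UR) (Sstar γ UL UR) UL) := by
  have hcL := sound_pos hγ hL
  have hcR := sound_pos hγ hR
  have h1 := SL_sub_vel_left_le (γ := γ) (UL := UL) (UR := UR)
  have h2 := le_SR_sub_vel_right (γ := γ) (UL := UL) (UR := UR)
  have hD := Sstar_denom_neg hγ hL hR
  have hS : Sstar γ UL UR *
      (UL.1 * (SL γ UL UR - vel UL) - UR.1 * (SR γ UL UR - vel UR)) =
      press γ UR - press γ UL + UL.1 * vel UL * (SL γ UL UR - vel UL)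
      - UR.1 * vel UR * (SR γ UL UR - vel UR) := div_mul_cancel₀ _ hD.ne
  have hP : press γ UR + UR.1 * (SR γ UL UR - vel UR) * (Sstar γ UL UR - vel UR) =
      press γ UL + UL.1 * (SL γ UL UR - vel UL) * (Sstar γ UL UR - vel UL) := by
    linear_combination -hS
  rw [Fstar_eq hR (sub_pos.mpr (Sstar_lt_SR hγ hL hR)).ne' (by linarith : _ < _).ne',
    Fstar_eq hL (sub_neg.mpr (SL_lt_Sstar hγ hL hR)).ne (by linarith : _ < _).ne, hP, smul_sub]
  abel

theorem neg_SL_le {a : ℝ} (hL : alphaMax γ UL ≤ a) (hR : alphaMax γ UR ≤ a) :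
    -SL γ UL UR ≤ a := by
  rw [neg_le]
  unfold alphaMax at hL hR
  refine le_min ?_ ?_ <;> unfold alphaMinus
  · linarith [neg_abs_le (vel UL)]
  · linarith [neg_abs_le (vel UR)]

theorem SR_le {a : ℝ} (hL : alphaMax γ UL ≤ a) (hR : alphaMax γ UR ≤ a) :
    SR γ UL UR ≤ a := by
  unfold alphaMax at hL hR
  refine max_le ?_ ?_ <;> unfold alphaPlus
  · linarith [le_abs_self (vel UL)]
  · linarith [le_abs_self (vel UR)]

theorem apply_Fhllc_lt (hγ : 1 < γ) (hL : UL ∈ admG) (hR : UR ∈ admG) {a : ℝ}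
    (haL : alphaMax γ UL ≤ a) (haR : alphaMax γ UR ≤ a)
    {φ : St →ₗ[ℝ] ℝ} (hφ : ∀ U ∈ admG, 0 < φ U) :
    φ (Fhllc γ UL UR) < 2 * a * φ UL := by
  have hsL := Ustar_left_mem_admG hγ hL hR
  have hsR := Ustar_right_mem_admG hγ hL hR
  have h1 := SL_lt_Sstar hγ hL hR
  have h2 := Sstar_lt_SR hγ hL hR
  have h3 := neg_SL_le haL haR
  have hRH := congrArg φ (Fstar_right_sub_left hγ hL hR)
  have hF := hφ _ (sub_eulerF_mem_admG hγ hL haL)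
  have pL := hφ _ hL
  have pR := hφ _ hR
  have psL := hφ _ hsL
  have psR := hφ _ hsR
  have ha : 0 < a := (alphaMax_pos hγ hL).trans_le haL
  have hap := mul_pos ha pL
  have hq := mul_nonneg (sub_nonneg.mpr h3) pL.le
  simp only [Fstar, map_sub, map_add, map_smul, smul_eq_mul] at hRH hF
  unfold Fhllc
  split_ifs with c1 c2 c3
  · linarith
  all_goals push Not at *
  · simp only [Fstar, map_sub, map_add, map_smul, smul_eq_mul]
    have := mul_pos (neg_pos.mpr c1) psL
    linarith
  · simp only [Fstar, map_sub, map_add, map_smul, smul_eq_mul]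
    have := mul_pos (sub_pos.mpr h1) psL
    have := mul_pos (neg_pos.mpr c2) psR
    linarith
  · have := mul_pos (sub_pos.mpr h1) psL
    have := mul_pos (sub_pos.mpr h2) psR
    have := mul_pos (neg_pos.mpr c3) pR
    linarith

theorem neg_apply_Fhllc_lt (hγ : 1 < γ) (hL : UL ∈ admG) (hR : UR ∈ admG) {a : ℝ}
    (haL : alphaMax γ UL ≤ a) (haR : alphaMax γ UR ≤ a)
    {φ : St →ₗ[ℝ] ℝ} (hφ : ∀ U ∈ admG, 0 < φ U) :
    -φ (Fhllc γ UL UR) < 2 * a * φ UR := by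
  have hsL := Ustar_left_mem_admG hγ hL hR
  have hsR := Ustar_right_mem_admG hγ hL hR
  have h1 := SL_lt_Sstar hγ hL hR
  have h2 := Sstar_lt_SR hγ hL hR
  have h3 := SR_le haL haR
  have hRH := congrArg φ (Fstar_right_sub_left hγ hL hR)
  have hF := hφ _ (add_eulerF_mem_admG hγ hR haR)
  have pL := hφ _ hL
  have pR := hφ _ hR
  have psL := hφ _ hsL
  have psR := hφ _ hsR
  have ha : 0 < a := (alphaMax_pos hγ hL).trans_le haL
  have hap := mul_pos ha pR
  have hq := mul_nonneg (sub_nonneg.mpr h3) pR.le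
  simp only [Fstar, map_sub, map_add, map_smul, smul_eq_mul] at hRH hF
  unfold Fhllc
  split_ifs with c1 c2 c3
  · have := mul_pos (sub_pos.mpr h1) psL
    have := mul_pos (sub_pos.mpr h2) psR
    have := mul_nonneg c1 pL.le
    linarith
  all_goals push Not at *
  · simp only [Fstar, map_sub, map_add, map_smul, smul_eq_mul]
    have := mul_pos (sub_pos.mpr h2) psR
    have := mul_nonneg c2 psL.le
    linarith
  · simp only [Fstar, map_sub, map_add, map_smul, smul_eq_mul]
    have := mul_nonneg c3 psR.le
    linarith
  · linarith

end Cone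

theorem sum_smul_mem_admG {n : ℕ} (hn : 0 < n) {w : Fin n → ℝ} (hw : ∀ i, 0 < w i)
    {V : Fin n → St} (hV : ∀ i, V i ∈ admG) : ∑ i, w i • V i ∈ admG := by
  have : Nonempty (Fin n) := Fin.pos_iff_nonempty.mp hn
  refine mem_admG_of_energyFunctional_pos ?_ fun v => ?_
  · simp only [Prod.fst_sum, Prod.smul_fst, smul_eq_mul]
    exact Finset.sum_pos (fun i _ => mul_pos (hw i) (hV i).1) Finset.univ_nonempty
  · simp only [map_sum, map_smul, smul_eq_mul]
    exact Finset.sum_pos (fun i _ => mul_pos (hw i) (energyFunctional_pos v (hV i)))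
      Finset.univ_nonempty

/-- Theorem 3.3: weak positivity of the high-order 1D
well-balanced DG scheme with modified HLLC flux and well-balanced source. -/
theorem high_order_WB_weak_positivity (γ : ℝ) (hγ : 1 < γ)
    (h Δt : ℝ) (hh : 0 < h) (hΔt : 0 < Δt)
    (L N : ℕ) (hL : 2 ≤ L) (hN : 1 ≤ N)
    -- quadrature weights
    (ωhat : Fin L → ℝ) (hωhat : ∀ ν, 0 < ωhat ν)
    (hωhatsum : ∑ ν, ωhat ν = 1)
    (hωhatsym : ωhat ⟨0, by omega⟩ = ωhat ⟨L - 1, by omega⟩)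
    (ω : Fin N → ℝ) (hω : ∀ μ, 0 < ω μ) (hωsum : ∑ μ, ω μ = 1)
    -- exterior interface traces
    (Uml Upr : St) (hUml : Uml ∈ admG) (hUpr : Upr ∈ admG)
    -- Gauss–Lobatto point values (interior traces are V 0 and V (L-1))
    (V : Fin L → St) (hV : ∀ ν, V ν ∈ admG)
    -- Gauss point values
    (W : Fin N → St) (hW : ∀ μ, W μ ∈ admG)
    -- the cell average, written both ways
    (havg : ∑ ν, ωhat ν • V ν = ∑ μ, ω μ • W μ)
    -- equilibrium data at Gauss points
    (ρe pe dcoef : Fin N → ℝ) (hρe : ∀ μ, 0 < ρe μ) (hpe : ∀ μ, 0 < pe μ)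
    -- equilibrium interface traces
    (peml pepl pemr pepr : ℝ)
    (hpeml : 0 < peml) (hpepl : 0 < pepl) (hpemr : 0 < pemr) (hpepr : 0 < pepr)
    (ρebar : ℝ) (hρebar : 0 < ρebar)
    -- quadrature-exactness identity
    (hquad : h * ∑ μ, ω μ * dcoef μ = pemr - pepl)
    -- CFL condition
    (hcfl :
      Δt * (2 * max ((pemr + pepr) / 2 / pemr) ((peml + pepl) / 2 / pepl) *
            max (max (alphaMax γ Uml) (alphaMax γ (V ⟨0, by omega⟩)))
              (max (alphaMax γ (V ⟨L - 1, by omega⟩)) (alphaMax γ Upr))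
          + ωhat ⟨0, by omega⟩ * h *
            Finset.univ.sup'
              (Finset.univ_nonempty_iff.mpr (Fin.pos_iff_nonempty.mp (by omega)))
              (fun μ => |dcoef μ| / (ρe μ * Real.sqrt (2 * specE (W μ))))
          + ωhat ⟨0, by omega⟩ *
            |(pepr - pemr) + (pepl - peml)| /
              (2 * ρebar * Real.sqrt (2 * specE (∑ ν, ωhat ν • V ν))))
        ≤ ωhat ⟨0, by omega⟩ * h) :
    (∑ ν, ωhat ν • V ν) -
        (Δt / h) •
          (Fhllc γ (((pemr + pepr) / 2 / pemr) • V ⟨L - 1, by omega⟩)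
              (((pemr + pepr) / 2 / pepr) • Upr)
            - Fhllc γ (((peml + pepl) / 2 / peml) • Uml)
                (((peml + pepl) / 2 / pepl) • V ⟨0, by omega⟩))
      + Δt •
        ((0 : ℝ),
          ∑ μ, ω μ * ((W μ).1 / ρe μ - (∑ ν, ωhat ν • V ν).1 / ρebar) * dcoef μ
            + (∑ ν, ωhat ν • V ν).1 / (ρebar * h) *
                ((pemr + pepr) / 2 - (peml + pepl) / 2),
          ∑ μ, ω μ * ((W μ).2.1 / ρe μ - (∑ ν, ωhat ν • V ν).2.1 / ρebar) * dcoef μ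
            + (∑ ν, ωhat ν • V ν).2.1 / (ρebar * h) *
                ((pemr + pepr) / 2 - (peml + pepl) / 2)) ∈ admG := by
  have hUb : ∑ ν, ωhat ν • V ν ∈ admG := sum_smul_mem_admG (by omega) hωhat hV
  have hb0 : (⟨0, by omega⟩ : Fin L) ≠ ⟨L - 1, by omega⟩ := by
    simp only [ne_eq, Fin.mk.injEq]
    omega
  have hN0 : (Finset.univ : Finset (Fin N)).Nonempty :=
    Finset.univ_nonempty_iff.mpr (Fin.pos_iff_nonempty.mp (by omega))
  have hsource : ((0 : ℝ),
      ∑ μ, ω μ * ((W μ).1 / ρe μ - (∑ ν, ωhat ν • V ν).1 / ρebar) * dcoef μ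
        + (∑ ν, ωhat ν • V ν).1 / (ρebar * h) * ((pemr + pepr) / 2 - (peml + pepl) / 2),
      ∑ μ, ω μ * ((W μ).2.1 / ρe μ - (∑ ν, ωhat ν • V ν).2.1 / ρebar) * dcoef μ
        + (∑ ν, ωhat ν • V ν).2.1 / (ρebar * h) * ((pemr + pepr) / 2 - (peml + pepl) / 2)) =
      ∑ μ, (ω μ * (dcoef μ / ρe μ)) • sourceDir (W μ) +
        (((pepr - pemr) + (pepl - peml)) / (2 * ρebar * h)) •
          sourceDir (∑ ν, ωhat ν • V ν) := by
    have hq : ∑ μ, ω μ * dcoef μ = (pemr - pepl) / h := by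
      rw [← hquad, mul_div_cancel_left₀ _ hh.ne']
    have key : ∀ (f : Fin N → ℝ) (b : ℝ),
        ∑ μ, ω μ * (f μ / ρe μ - b / ρebar) * dcoef μ
          + b / (ρebar * h) * ((pemr + pepr) / 2 - (peml + pepl) / 2) =
        ∑ μ, ω μ * (dcoef μ / ρe μ) * f μ +
          ((pepr - pemr) + (pepl - peml)) / (2 * ρebar * h) * b := by
      intro f b
      have : ∀ μ, ω μ * (f μ / ρe μ - b / ρebar) * dcoef μ =
          ω μ * (dcoef μ / ρe μ) * f μ - b / ρebar * (ω μ * dcoef μ) := fun μ => by ring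
      simp only [this, Finset.sum_sub_distrib, ← Finset.mul_sum, hq]
      field_simp
      ring
    refine Prod.ext ?_ (Prod.ext ?_ ?_)
    · simp [Prod.fst_sum, sourceDir_apply]
    · exact (key (fun μ => (W μ).1) _).trans
        (by simp [Prod.fst_sum, Prod.snd_sum, sourceDir_apply])
    · exact (key (fun μ => (W μ).2.1) _).trans
        (by simp [Prod.fst_sum, Prod.snd_sum, sourceDir_apply])
  rw [hsource]
  set Ub := ∑ ν, ωhat ν • V ν with hUbdef
  set w := ωhat ⟨0, by omega⟩ with hwdef
  set V0 := V ⟨0, by omega⟩ with hV0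
  set V1 := V ⟨L - 1, by omega⟩ with hV1
  set a := max (max (alphaMax γ Uml) (alphaMax γ V0)) (max (alphaMax γ V1) (alphaMax γ Upr))
    with ha
  set r := max ((pemr + pepr) / 2 / pemr) ((peml + pepl) / 2 / pepl) with hr
  set M := Finset.univ.sup' hN0 (fun μ => |dcoef μ| / (ρe μ * Real.sqrt (2 * specE (W μ))))
    with hM
  set J := (pepr - pemr) + (pepl - peml) with hJ
  have hw : 0 < w := hωhat _
  have hr1 : 0 < (pemr + pepr) / 2 / pemr := by positivity
  have hr2 : 0 < (pemr + pepr) / 2 / pepr := by positivity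
  have hr3 : 0 < (peml + pepl) / 2 / peml := by positivity
  have hr4 : 0 < (peml + pepl) / 2 / pepl := by positivity
  have ha0 : 0 < a :=
    (alphaMax_pos hγ hUml).trans_le ((le_max_left _ _).trans (le_max_left _ _))
  have hMle : ∀ μ, |dcoef μ / ρe μ| ≤ M * Real.sqrt (2 * specE (W μ)) := by
    intro μ
    have hs : 0 < Real.sqrt (2 * specE (W μ)) :=
      Real.sqrt_pos.mpr (mul_pos two_pos (specE_pos (hW μ)))
    rw [← div_le_iff₀ hs, abs_div, abs_of_pos (hρe μ), div_div]
    exact Finset.le_sup' (fun μ => |dcoef μ| / (ρe μ * Real.sqrt (2 * specE (W μ))))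
      (Finset.mem_univ μ)
  have hs : 0 < Real.sqrt (2 * specE Ub) := Real.sqrt_pos.mpr (mul_pos two_pos (specE_pos hUb))
  have hJle : |J / (2 * ρebar * h)| ≤
      |J| / (2 * ρebar * Real.sqrt (2 * specE Ub)) / h * Real.sqrt (2 * specE Ub) := by
    rw [abs_div, abs_of_pos (by positivity : 0 < 2 * ρebar * h)]
    apply le_of_eq
    field_simp
  set K := |J| / (2 * ρebar * Real.sqrt (2 * specE Ub)) / h with hK
  have hcfl' : Δt / h * (2 * r * a) / w + Δt * M + Δt * K ≤ 1 := by
    rw [← div_le_one (mul_pos hw hh)] at hcfl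
    refine le_trans (le_of_eq ?_) hcfl
    rw [hK]
    field_simp
  have main : ∀ φ : St →ₗ[ℝ] ℝ, (∀ U ∈ admG, 0 < φ U) →
      (∀ U ∈ admG, ∀ c t : ℝ, |t| ≤ c * Real.sqrt (2 * specE U) →
        0 ≤ c * φ U + t * φ (sourceDir U)) →
      0 < φ (Ub - (Δt / h) • (Fhllc γ (((pemr + pepr) / 2 / pemr) • V1)
              (((pemr + pepr) / 2 / pepr) • Upr)
            - Fhllc γ (((peml + pepl) / 2 / peml) • Uml) (((peml + pepl) / 2 / pepl) • V0))
          + Δt • (∑ μ, (ω μ * (dcoef μ / ρe μ)) • sourceDir (W μ) +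
            (J / (2 * ρebar * h)) • sourceDir Ub)) := by
    intro φ hφ hsrc
    have pUb := hφ _ hUb
    have pV0 := hφ V0 (hV _)
    have pV1 := hφ V1 (hV _)
    have f1 : φ (Fhllc γ (((pemr + pepr) / 2 / pemr) • V1)
        (((pemr + pepr) / 2 / pepr) • Upr)) < 2 * r * a * φ V1 := by
      refine (apply_Fhllc_lt (a := a) hγ (smul_mem_admG hr1 (hV _)) (smul_mem_admG hr2 hUpr)
        ?_ ?_ hφ).trans_le ?_
      · rw [alphaMax_smul γ hr1]
        exact (le_max_left _ _).trans (le_max_right _ _)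
      · rw [alphaMax_smul γ hr2]
        exact (le_max_right _ _).trans (le_max_right _ _)
      · rw [map_smul, smul_eq_mul]
        have := mul_le_mul_of_nonneg_right (le_max_left _ _ : _ ≤ r) (mul_pos ha0 pV1).le
        linarith
    have f0 : -φ (Fhllc γ (((peml + pepl) / 2 / peml) • Uml)
        (((peml + pepl) / 2 / pepl) • V0)) < 2 * r * a * φ V0 := by
      refine (neg_apply_Fhllc_lt (a := a) hγ (smul_mem_admG hr3 hUml) (smul_mem_admG hr4 (hV _))
        ?_ ?_ hφ).trans_le ?_
      · rw [alphaMax_smul γ hr3]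
        exact (le_max_left _ _).trans (le_max_left _ _)
      · rw [alphaMax_smul γ hr4]
        exact (le_max_right _ _).trans (le_max_left _ _)
      · rw [map_smul, smul_eq_mul]
        have := mul_le_mul_of_nonneg_right (le_max_right _ _ : _ ≤ r) (mul_pos ha0 pV0).le
        linarith
    have hends : w * (φ V0 + φ V1) ≤ φ Ub := by
      have := Finset.add_le_sum (f := fun ν => ωhat ν * φ (V ν))
        (fun ν _ => (mul_pos (hωhat ν) (hφ _ (hV ν))).le) (Finset.mem_univ _)
        (Finset.mem_univ _) hb0
      rw [← hωhatsym] at this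
      rw [hUbdef]
      simp only [map_sum, map_smul, smul_eq_mul]
      linarith
    have hflux : Δt / h * (φ (Fhllc γ (((pemr + pepr) / 2 / pemr) • V1)
          (((pemr + pepr) / 2 / pepr) • Upr)) -
        φ (Fhllc γ (((peml + pepl) / 2 / peml) • Uml) (((peml + pepl) / 2 / pepl) • V0))) <
        Δt / h * (2 * r * a) / w * φ Ub := by
      have hr0 : 0 < r := hr1.trans_le (le_max_left _ _)
      calc _ < Δt / h * (2 * r * a * (φ V0 + φ V1)) := by
            gcongr
            linarith
        _ = Δt / h * (2 * r * a) / w * (w * (φ V0 + φ V1)) := by field_simp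
        _ ≤ _ := by gcongr
    have hgauss : 0 ≤ M * φ Ub + ∑ μ, ω μ * (dcoef μ / ρe μ) * φ (sourceDir (W μ)) := by
      rw [havg]
      simp only [map_sum, map_smul, smul_eq_mul, Finset.mul_sum, ← Finset.sum_add_distrib]
      refine Finset.sum_nonneg fun μ _ => ?_
      have := mul_nonneg (hω μ).le (hsrc _ (hW μ) _ _ (hMle μ))
      linarith
    have hmean := hsrc _ hUb _ _ hJle
    simp only [map_add, map_sub, map_smul, map_sum, smul_eq_mul]
    have e1 := mul_le_mul_of_nonneg_right hcfl' pUb.le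
    have e2 := mul_nonneg hΔt.le hgauss
    have e3 := mul_nonneg hΔt.le hmean
    linarith
  refine mem_admG_of_energyFunctional_pos ?_ fun v => ?_
  · refine main (LinearMap.fst ℝ ℝ (ℝ × ℝ)) (fun U hU => hU.1) fun U hU c t ht => ?_
    have hc : 0 ≤ c := nonneg_of_mul_nonneg_left ((abs_nonneg t).trans ht)
      (Real.sqrt_pos.mpr (mul_pos two_pos (specE_pos hU)))
    simpa [sourceDir_apply] using mul_nonneg hc hU.1.le
  · exact main (energyFunctional v) (fun U hU => energyFunctional_pos v hU)
      fun U hU c t ht => energyFunctional_add_source_nonneg v hU ht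
end

section
/- Positivity of the first-order 2D well-balanced DG scheme (Theorem 4.2): let E(K) be a nonempty finite index set (the edges of a cell K), with for each ℰ ∈ E(K) a length |ℰ| > 0, a unit outward normal n_ℰ ∈ ℝ², a neighbor cell average Ū_{K_ℰ} ∈ G, and a neighbor equilibrium pressure average p̄^e_{K_ℰ} > 0; let |K| > 0, Ū_K = (ρ̄_K, m̄_K, Ē_K) ∈ G, p̄^e_K > 0, ρ̄^e_K > 0, and set ē_K = (Ē_K − ‖m̄_K‖²/(2ρ̄_K))/ρ̄_K. For each edge set p^{e,⋆}_ℰ = (p̄^e_K + p̄^e_{K_ℰ})/2 and define the flux F̂_ℰ = F^hllc((p^{e,⋆}_ℰ/p̄^e_K) Ū_K, (p^{e,⋆}_ℰ/p̄^e_{K_ℰ}) Ū_{K_ℰ}; n_ℰ). Set a = Σ_{ℰ∈E(K)} |ℰ| p^{e,⋆}_ℰ n_ℰ ∈ ℝ², the discretized source S̄_K = (1/(|K| ρ̄^e_K)) · (0, ρ̄_K a, m̄_K·a), and the constants α̂^F_K = max over ℰ ∈ E(K) of max{α_{n_ℰ}(Ū_K), α_{n_ℰ}(Ū_{K_ℰ})}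 and α̂^S_K = ‖a‖/(|K| ρ̄^e_K √(2ē_K)). If Δt > 0 satisfies Δt·(2(α̂^F_K/|K|)·Σ_{ℰ∈E(K)} |ℰ| p^{e,⋆}_ℰ/p̄^e_K + α̂^S_K) ≤ 1, then Ū_K − (Δt/|K|)·Σ_{ℰ∈E(K)} |ℰ| F̂_ℰ + Δt·S̄_K ∈ G. -/
open scoped RealInnerProductSpace

noncomputable section

/-- A 2D state `U = (ρ, m, E)` with momentum vector `m ∈ ℝ²`. -/
abbrev St2 : Type := ℝ × EuclideanSpace ℝ (Fin 2) × ℝ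

/-- The admissible set `G = {(ρ, m, E) : ρ > 0, E − ‖m‖²/(2ρ) > 0}`. -/
def admG2 : Set St2 := {U | 0 < U.1 ∧ 0 < U.2.2 - ‖U.2.1‖ ^ 2 / (2 * U.1)}

/-- The pressure `p = (γ−1)(E − ‖m‖²/(2ρ))`. -/
def press2 (γ : ℝ) (U : St2) : ℝ := (γ - 1) * (U.2.2 - ‖U.2.1‖ ^ 2 / (2 * U.1))

/-- The sound speed `√(γ p / ρ)`. -/
def sound2 (γ : ℝ) (U : St2) : ℝ := Real.sqrt (γ * press2 γ U / U.1)

/-- The normal velocity `q(U) = u·n = (m·n)/ρ`. -/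
def qvel (U : St2) (n : EuclideanSpace ℝ (Fin 2)) : ℝ := ⟪U.2.1, n⟫ / U.1

/-- The directional Euler flux `F(U)·n = (ρq, q m + p n, (E+p)q)`. -/
def eulerFn (γ : ℝ) (U : St2) (n : EuclideanSpace ℝ (Fin 2)) : St2 :=
  (U.1 * qvel U n, qvel U n • U.2.1 + press2 γ U • n,
    (U.2.2 + press2 γ U) * qvel U n)

/-- `α_n(U) = |u·n| + √(γp/ρ)`. -/
def alphaN (γ : ℝ) (U : St2) (n : EuclideanSpace ℝ (Fin 2)) : ℝ :=
  |qvel U n| + sound2 γ U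

/-- Left wave speed of the 2D HLLC flux. -/
def SL2 (γ : ℝ) (UL UR : St2) (n : EuclideanSpace ℝ (Fin 2)) : ℝ :=
  min (qvel UL n - sound2 γ UL) (qvel UR n - sound2 γ UR)

/-- Right wave speed of the 2D HLLC flux. -/
def SR2 (γ : ℝ) (UL UR : St2) (n : EuclideanSpace ℝ (Fin 2)) : ℝ :=
  max (qvel UL n + sound2 γ UL) (qvel UR n + sound2 γ UR)

/-- Middle wave speed of the 2D HLLC flux. -/
def Sstar2 (γ : ℝ) (UL UR : St2) (n : EuclideanSpace ℝ (Fin 2)) : ℝ :=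
  (press2 γ UR - press2 γ UL + UL.1 * qvel UL n * (SL2 γ UL UR n - qvel UL n)
      - UR.1 * qvel UR n * (SR2 γ UL UR n - qvel UR n)) /
    (UL.1 * (SL2 γ UL UR n - qvel UL n) - UR.1 * (SR2 γ UL UR n - qvel UR n))

/-- 2D HLLC intermediate state. -/
def Ustar2 (γ : ℝ) (Si Sst : ℝ) (Ui : St2) (n : EuclideanSpace ℝ (Fin 2)) : St2 :=
  ((Si - qvel Ui n) / (Si - Sst)) •
    ((Ui.1, Ui.2.1 + (Ui.1 * (Sst - qvel Ui n)) • n,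
      Ui.2.2 + Ui.1 * (Sst - qvel Ui n) *
        (Sst + press2 γ Ui / (Ui.1 * (Si - qvel Ui n)))) : St2)

/-- 2D intermediate flux `F_{*i} = F(U_i)·n + S_i (U_{*i} − U_i)`. -/
def Fstar2 (γ : ℝ) (Si Sst : ℝ) (Ui : St2) (n : EuclideanSpace ℝ (Fin 2)) : St2 :=
  eulerFn γ Ui n + Si • (Ustar2 γ Si Sst Ui n - Ui)

/-- The 2D HLLC numerical flux in direction `n`. -/
def Fhllc2 (γ : ℝ) (UL UR : St2) (n : EuclideanSpace ℝ (Fin 2)) : St2 :=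
  if 0 ≤ SL2 γ UL UR n then eulerFn γ UL n
  else if 0 ≤ Sstar2 γ UL UR n then Fstar2 γ (SL2 γ UL UR n) (Sstar2 γ UL UR n) UL n
  else if 0 ≤ SR2 γ UL UR n then Fstar2 γ (SR2 γ UL UR n) (Sstar2 γ UL UR n) UR n
  else eulerFn γ UR n

end

/-- The specific internal energy `e = (E − ‖m‖²/(2ρ))/ρ` of a 2D state. -/
noncomputable def specE2 (U : St2) : ℝ := (U.2.2 - ‖U.2.1‖ ^ 2 / (2 * U.1)) / U.1

/-- The closed cone containing `admG2`, including degenerate states of zero internal energy. -/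
def closedAdmG2 : Set St2 := {U | 0 ≤ U.1 ∧ 0 ≤ U.2.2 ∧ ‖U.2.1‖ ^ 2 ≤ 2 * U.1 * U.2.2}

lemma mem_admG2_iff {U : St2} : U ∈ admG2 ↔ 0 < U.1 ∧ ‖U.2.1‖ ^ 2 < 2 * U.1 * U.2.2 := by
  refine and_congr_right fun h => ?_
  rw [sub_pos, div_lt_iff₀ (by positivity)]
  constructor <;> intro h' <;> linarith

lemma energy_pos_of_mem_admG2 {U : St2} (hU : U ∈ admG2) : 0 < U.2.2 := by
  have h := mem_admG2_iff.1 hU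
  exact pos_of_mul_pos_right ((sq_nonneg _).trans_lt h.2) (by linarith [h.1])

lemma admG2_subset_closedAdmG2 : admG2 ⊆ closedAdmG2 := fun _ hU =>
  ⟨hU.1.le, (energy_pos_of_mem_admG2 hU).le, (mem_admG2_iff.1 hU).2.le⟩

lemma smul_mem_admG2 {U : St2} (hU : U ∈ admG2) {c : ℝ} (hc : 0 < c) : c • U ∈ admG2 := by
  obtain ⟨h1, h2⟩ := mem_admG2_iff.1 hU
  refine mem_admG2_iff.2 ⟨mul_pos hc h1, ?_⟩
  simp only [Prod.smul_fst, Prod.smul_snd, norm_smul, smul_eq_mul, mul_pow, Real.norm_eq_abs,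
    sq_abs]
  nlinarith [mul_lt_mul_of_pos_left h2 (pow_pos hc 2)]

lemma smul_mem_closedAdmG2 {U : St2} (hU : U ∈ closedAdmG2) {c : ℝ} (hc : 0 ≤ c) :
    c • U ∈ closedAdmG2 := by
  obtain ⟨h1, h2, h3⟩ := hU
  refine ⟨mul_nonneg hc h1, mul_nonneg hc h2, ?_⟩
  simp only [Prod.smul_fst, Prod.smul_snd, norm_smul, smul_eq_mul, mul_pow, Real.norm_eq_abs,
    sq_abs]
  nlinarith [mul_le_mul_of_nonneg_left h3 (pow_nonneg hc 2)]

lemma norm_mul_norm_le_of_mem_closedAdmG2 {U V : St2} (hU : U ∈ closedAdmG2)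
    (hV : V ∈ closedAdmG2) : ‖U.2.1‖ * ‖V.2.1‖ ≤ U.1 * V.2.2 + V.1 * U.2.2 := by
  obtain ⟨u1, u2, u3⟩ := hU
  obtain ⟨v1, v2, v3⟩ := hV
  refine abs_le_of_sq_le_sq' ?_ (by positivity) |>.2
  have := mul_le_mul u3 v3 (sq_nonneg _) (by positivity)
  nlinarith [sq_nonneg (U.1 * V.2.2 - V.1 * U.2.2)]

lemma add_mem_admG2 {U V : St2} (hU : U ∈ admG2) (hV : V ∈ closedAdmG2) : U + V ∈ admG2 := by
  have hc := norm_mul_norm_le_of_mem_closedAdmG2 (admG2_subset_closedAdmG2 hU) hV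
  obtain ⟨u1, u2⟩ := mem_admG2_iff.1 hU
  obtain ⟨v1, v2, v3⟩ := hV
  refine mem_admG2_iff.2 ⟨add_pos_of_pos_of_nonneg u1 v1, ?_⟩
  have hn : ‖U.2.1 + V.2.1‖ ^ 2 ≤ (‖U.2.1‖ + ‖V.2.1‖) ^ 2 := by
    gcongr
    exact norm_add_le _ _
  simp only [Prod.fst_add, Prod.snd_add]
  nlinarith

lemma press2_pos {γ : ℝ} (hγ : 1 < γ) {U : St2} (hU : U ∈ admG2) : 0 < press2 γ U :=
  mul_pos (sub_pos.2 hγ) hU.2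

lemma sound2_sq {γ : ℝ} (hγ : 1 < γ) {U : St2} (hU : U ∈ admG2) :
    U.1 * sound2 γ U ^ 2 = γ * press2 γ U := by
  have hp := press2_pos hγ hU
  have h1 := hU.1
  rw [sound2, Real.sq_sqrt (by positivity)]
  field_simp

lemma sound2_pos {γ : ℝ} (hγ : 1 < γ) {U : St2} (hU : U ∈ admG2) : 0 < sound2 γ U := by
  have hp := press2_pos hγ hU
  have h1 := hU.1
  exact Real.sqrt_pos.2 (by positivity)

lemma press2_lt_mul {γ : ℝ} (hγ : 1 < γ) {U : St2} (hU : U ∈ admG2) {a b : ℝ}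
    (ha : sound2 γ U ≤ a) (hb : sound2 γ U ≤ b) : press2 γ U < U.1 * (a * b) := by
  have hc := sound2_pos hγ hU
  have h := mul_le_mul_of_nonneg_left (mul_le_mul ha hb hc.le (hc.le.trans ha)) hU.1.le
  nlinarith [sound2_sq hγ hU, press2_pos hγ hU]

lemma press2_sq_lt {γ : ℝ} (hγ : 1 < γ) {U : St2} (hU : U ∈ admG2) {t : ℝ}
    (ht : sound2 γ U ≤ |t|) :
    press2 γ U ^ 2 < (2 * U.1 * U.2.2 - ‖U.2.1‖ ^ 2) * t ^ 2 := by
  have h1 := hU.1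
  have hp := press2_pos hγ hU
  have hl : γ * press2 γ U ≤ U.1 * t ^ 2 := by
    rw [← sound2_sq hγ hU, ← sq_abs t]
    have := sound2_pos hγ hU
    gcongr
  have he : 0 < U.2.2 - ‖U.2.1‖ ^ 2 / (2 * U.1) := hU.2
  have hpe : press2 γ U = (γ - 1) * (U.2.2 - ‖U.2.1‖ ^ 2 / (2 * U.1)) := rfl
  have hr : 2 * U.1 * U.2.2 - ‖U.2.1‖ ^ 2 = 2 * U.1 * (U.2.2 - ‖U.2.1‖ ^ 2 / (2 * U.1)) := by
    field_simp
  rw [hr]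
  set e := U.2.2 - ‖U.2.1‖ ^ 2 / (2 * U.1)
  have := mul_le_mul_of_nonneg_left hl he.le
  nlinarith [mul_pos he hp]

lemma inner_eq_density_mul_qvel {U : St2} (hU : U ∈ admG2) (n : EuclideanSpace ℝ (Fin 2)) :
    ⟪U.2.1, n⟫ = U.1 * qvel U n := by
  have := hU.1
  rw [qvel]
  field_simp

lemma norm_smul_add_smul_sq {n : EuclideanSpace ℝ (Fin 2)} (hn : ‖n‖ = 1)
    (m : EuclideanSpace ℝ (Fin 2)) (a b : ℝ) :
    ‖a • m + b • n‖ ^ 2 = a ^ 2 * ‖m‖ ^ 2 + 2 * a * b * ⟪m, n⟫ + b ^ 2 := by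
  rw [norm_add_sq_real, norm_smul, norm_smul, inner_smul_left, inner_smul_right, hn, mul_pow,
    mul_one, Real.norm_eq_abs, Real.norm_eq_abs, sq_abs, sq_abs]
  simp
  ring

/-- The Lax–Friedrichs property of the Euler flux. -/
lemma smul_sub_eulerFn_mem_admG2 {γ : ℝ} (hγ : 1 < γ) {U : St2} (hU : U ∈ admG2)
    {n : EuclideanSpace ℝ (Fin 2)} (hn : ‖n‖ = 1) {s : ℝ} (hs : alphaN γ U n ≤ s) :
    s • U - eulerFn γ U n ∈ admG2 := by
  have hc := sound2_pos hγ hU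
  have ht : sound2 γ U ≤ s - qvel U n := by
    have := le_abs_self (qvel U n)
    unfold alphaN at hs
    linarith
  have hp := press2_sq_lt hγ hU (ht.trans (le_abs_self _))
  have h1 := hU.1
  have ht0 : 0 < s - qvel U n := hc.trans_le ht
  have hi := inner_eq_density_mul_qvel hU n
  refine mem_admG2_iff.2 ⟨?_, ?_⟩
  · change 0 < s * U.1 - U.1 * qvel U n
    nlinarith
  · change ‖s • U.2.1 - (qvel U n • U.2.1 + press2 γ U • n)‖ ^ 2
      < 2 * (s * U.1 - U.1 * qvel U n) * (s * U.2.2 - (U.2.2 + press2 γ U) * qvel U n)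
    have hv : s • U.2.1 - (qvel U n • U.2.1 + press2 γ U • n)
        = (s - qvel U n) • U.2.1 + (-press2 γ U) • n := by module
    rw [hv, norm_smul_add_smul_sq hn, hi]
    linarith

/-- Admissibility of an HLLC intermediate state. -/
lemma Ustar2_mem_admG2 {γ : ℝ} (hγ : 1 < γ) {U : St2} (hU : U ∈ admG2)
    {n : EuclideanSpace ℝ (Fin 2)} (hn : ‖n‖ = 1) {S Sst : ℝ}
    (hS : sound2 γ U ≤ |S - qvel U n|) (hk : 0 < (S - qvel U n) / (S - Sst)) :
    Ustar2 γ S Sst U n ∈ admG2 := by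
  have h1 := hU.1
  have hp := press2_sq_lt hγ hU hS
  have ht : S - qvel U n ≠ 0 := fun h => by simp [h] at hk
  have hi := inner_eq_density_mul_qvel hU n
  unfold Ustar2
  refine smul_mem_admG2 ?_ hk
  refine mem_admG2_iff.2 ⟨h1, ?_⟩
  have hv : U.2.1 + (U.1 * (Sst - qvel U n)) • n
      = (1 : ℝ) • U.2.1 + (U.1 * (Sst - qvel U n)) • n := by module
  simp only
  rw [hv, norm_smul_add_smul_sq hn, hi]
  set q := qvel U n
  set r := press2 γ U / (S - q) with hr
  have hr2 : press2 γ U / (U.1 * (S - q)) = r / U.1 := by rw [hr]; field_simp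
  have hrp : press2 γ U = r * (S - q) := by rw [hr]; field_simp
  have hlt : r ^ 2 < 2 * U.1 * U.2.2 - ‖U.2.1‖ ^ 2 := by
    have : 0 < (S - q) ^ 2 := by positivity
    rw [hrp, mul_pow] at hp
    exact lt_of_mul_lt_mul_right hp this.le
  have hE : 2 * U.1 * (U.2.2 + U.1 * (Sst - q) * (Sst + press2 γ U / (U.1 * (S - q))))
      = 2 * U.1 * U.2.2 + 2 * U.1 ^ 2 * (Sst - q) * Sst + 2 * U.1 * (Sst - q) * r := by
    rw [hr2]
    field_simp
    ring
  rw [hE]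
  nlinarith [sq_nonneg (U.1 * (Sst - q) + r)]

/-- The intermediate flux is the transport of the intermediate state with the contact speed plus
a pressure term. -/
lemma Fstar2_eq {γ : ℝ} {U : St2} (hU : U ∈ admG2) (n : EuclideanSpace ℝ (Fin 2)) {S Sst : ℝ}
    (hS : S - qvel U n ≠ 0) (hSst : S - Sst ≠ 0) :
    Fstar2 γ S Sst U n = Sst • Ustar2 γ S Sst U n +
      (((0 : ℝ), (press2 γ U + U.1 * (S - qvel U n) * (Sst - qvel U n)) • n,
        (press2 γ U + U.1 * (S - qvel U n) * (Sst - qvel U n)) * Sst) : St2) := by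
  have h1 := hU.1.ne'
  unfold Fstar2 Ustar2 eulerFn
  set q := qvel U n
  set k := (S - q) / (S - Sst) with hk
  have hks : k * (S - Sst) = S - q := by rw [hk]; field_simp
  refine Prod.ext ?_ (Prod.ext ?_ ?_)
  · simp only [Prod.fst_add, Prod.smul_fst, Prod.fst_sub, smul_eq_mul]
    linear_combination U.1 * hks
  · simp only [Prod.fst_add, Prod.smul_fst, Prod.fst_sub, Prod.snd_add, Prod.smul_snd,
      Prod.snd_sub]
    linear_combination (norm := module) hks • (U.2.1 + (U.1 * (Sst - q)) • n)
  · simp only [Prod.snd_add, Prod.smul_snd, Prod.snd_sub, smul_eq_mul]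
    have hP : press2 γ U / (U.1 * (S - q)) * (U.1 * (S - q)) = press2 γ U := by field_simp
    set r := press2 γ U / (U.1 * (S - q))
    rw [← hP]
    linear_combination (U.2.2 + U.1 * (Sst - q) * (Sst + r)) * hks

section WaveSpeeds

variable {γ : ℝ} {UL UR : St2} (n : EuclideanSpace ℝ (Fin 2))

lemma sound2_le_qvel_left_sub_SL2 : sound2 γ UL ≤ qvel UL n - SL2 γ UL UR n := by
  have := min_le_left (qvel UL n - sound2 γ UL) (qvel UR n - sound2 γ UR)
  unfold SL2
  linarith

lemma sound2_le_qvel_right_sub_SL2 : sound2 γ UR ≤ qvel UR n - SL2 γ UL UR n := by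
  have := min_le_right (qvel UL n - sound2 γ UL) (qvel UR n - sound2 γ UR)
  unfold SL2
  linarith

lemma sound2_le_SR2_sub_qvel_left : sound2 γ UL ≤ SR2 γ UL UR n - qvel UL n := by
  have := le_max_left (qvel UL n + sound2 γ UL) (qvel UR n + sound2 γ UR)
  unfold SR2
  linarith

lemma sound2_le_SR2_sub_qvel_right : sound2 γ UR ≤ SR2 γ UL UR n - qvel UR n := by
  have := le_max_right (qvel UL n + sound2 γ UL) (qvel UR n + sound2 γ UR)
  unfold SR2
  linarith

lemma SL2_lt_Sstar2_lt_SR2 (hγ : 1 < γ) (hL : UL ∈ admG2) (hR : UR ∈ admG2) :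
    SL2 γ UL UR n < Sstar2 γ UL UR n ∧ Sstar2 γ UL UR n < SR2 γ UL UR n ∧
      press2 γ UL + UL.1 * (SL2 γ UL UR n - qvel UL n) * (Sstar2 γ UL UR n - qvel UL n) =
        press2 γ UR + UR.1 * (SR2 γ UL UR n - qvel UR n) * (Sstar2 γ UL UR n - qvel UR n) := by
  have h1 := sound2_le_qvel_left_sub_SL2 (γ := γ) (UL := UL) (UR := UR) n
  have h2 := sound2_le_qvel_right_sub_SL2 (γ := γ) (UL := UL) (UR := UR) n
  have h3 := sound2_le_SR2_sub_qvel_left (γ := γ) (UL := UL) (UR := UR) n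
  have h4 := sound2_le_SR2_sub_qvel_right (γ := γ) (UL := UL) (UR := UR) n
  have hcL := sound2_pos hγ hL
  have hcR := sound2_pos hγ hR
  have a1 := press2_lt_mul hγ hL h1 h1
  have a2 := press2_lt_mul hγ hL h1 h3
  have a3 := press2_lt_mul hγ hR h4 h4
  have a4 := press2_lt_mul hγ hR h4 h2
  have pL := press2_pos hγ hL
  have pR := press2_pos hγ hR
  unfold Sstar2
  set SL := SL2 γ UL UR n
  set SR := SR2 γ UL UR n
  set qL := qvel UL n
  set qR := qvel UR n
  have dL : 0 < UL.1 * (qL - SL) := mul_pos hL.1 (hcL.trans_le h1)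
  have dR : 0 < UR.1 * (SR - qR) := mul_pos hR.1 (hcR.trans_le h4)
  have hD : UL.1 * (SL - qL) - UR.1 * (SR - qR) < 0 := by linarith
  refine ⟨?_, ?_, ?_⟩
  · rw [lt_div_iff_of_neg hD]
    linarith
  · rw [div_lt_iff_of_neg hD]
    linarith
  · have hD' := hD.ne
    field_simp
    ring

end WaveSpeeds

/-- Admissibility of the one-sided HLLC update. -/
lemma smul_sub_Fhllc2_mem_admG2 {γ : ℝ} (hγ : 1 < γ) {UL UR : St2} (hL : UL ∈ admG2)
    (hR : UR ∈ admG2) {n : EuclideanSpace ℝ (Fin 2)} (hn : ‖n‖ = 1) {s : ℝ}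
    (hsL : alphaN γ UL n ≤ s) (hsR : alphaN γ UR n ≤ s) :
    (2 * s) • UL - Fhllc2 γ UL UR n ∈ admG2 := by
  obtain ⟨hls, hsr, hpeq⟩ := SL2_lt_Sstar2_lt_SR2 n hγ hL hR
  have h1 := sound2_le_qvel_left_sub_SL2 (γ := γ) (UL := UL) (UR := UR) n
  have h4 := sound2_le_SR2_sub_qvel_right (γ := γ) (UL := UL) (UR := UR) n
  have hcL := sound2_pos hγ hL
  have hcR := sound2_pos hγ hR
  have hsSL : 0 ≤ s + SL2 γ UL UR n := by
    unfold alphaN at hsL hsR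
    have hmin : -s ≤ SL2 γ UL UR n := le_min
      (by linarith [neg_abs_le (qvel UL n)]) (by linarith [neg_abs_le (qvel UR n)])
    linarith
  have hs : 0 ≤ s := by
    unfold alphaN at hsL
    linarith [abs_nonneg (qvel UL n)]
  have hLF := smul_sub_eulerFn_mem_admG2 hγ hL hn hsL
  unfold Fhllc2
  set SL := SL2 γ UL UR n
  set SR := SR2 γ UL UR n
  set Ss := Sstar2 γ UL UR n
  have hwL : Ustar2 γ SL Ss UL n ∈ admG2 := Ustar2_mem_admG2 hγ hL hn
    (h1.trans (by rw [abs_sub_comm]; exact le_abs_self _))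
    (div_pos_of_neg_of_neg (by linarith) (by linarith))
  have hwR : Ustar2 γ SR Ss UR n ∈ admG2 := Ustar2_mem_admG2 hγ hR hn
    (h4.trans (le_abs_self _)) (div_pos (by linarith) (by linarith))
  have hFL : Fstar2 γ SL Ss UL n = _ :=
    Fstar2_eq hL n (by linarith : SL - qvel UL n < 0).ne (by linarith : SL - Ss < 0).ne
  have hFR : Fstar2 γ SR Ss UR n = _ :=
    Fstar2_eq hR n (by linarith : 0 < SR - qvel UR n).ne' (by linarith : 0 < SR - Ss).ne'
  rw [← hpeq] at hFR
  have hRH : Fstar2 γ SR Ss UR n = Fstar2 γ SL Ss UL n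
      + Ss • (Ustar2 γ SR Ss UR n - Ustar2 γ SL Ss UL n) := by
    rw [hFL, hFR]
    module
  have cone {c : ℝ} {W : St2} (hc : 0 ≤ c) (hW : W ∈ admG2) : c • W ∈ closedAdmG2 :=
    smul_mem_closedAdmG2 (admG2_subset_closedAdmG2 hW) hc
  split_ifs with c1 c2 c3
  · have hdec := add_mem_admG2 hLF (cone hs hL)
    convert hdec using 1
    module
  · have hdec := add_mem_admG2 (add_mem_admG2 hLF (cone hsSL hL))
      (cone (by linarith : 0 ≤ -SL) hwL)
    convert hdec using 1
    unfold Fstar2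
    module
  · have hdec := add_mem_admG2 (add_mem_admG2 (add_mem_admG2 hLF (cone hsSL hL))
      (cone (by linarith : 0 ≤ Ss - SL) hwL)) (cone (by linarith : 0 ≤ -Ss) hwR)
    convert hdec using 1
    rw [hRH]
    unfold Fstar2
    module
  · have hdec := add_mem_admG2 (add_mem_admG2 (add_mem_admG2 (add_mem_admG2 hLF
      (cone hsSL hL)) (cone (by linarith : 0 ≤ Ss - SL) hwL))
      (cone (by linarith : 0 ≤ SR - Ss) hwR)) (cone (by linarith : 0 ≤ -SR) hR)
    convert hdec using 1
    have hF : eulerFn γ UR n = Fstar2 γ SL Ss UL n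
        + Ss • (Ustar2 γ SR Ss UR n - Ustar2 γ SL Ss UL n)
        - SR • (Ustar2 γ SR Ss UR n - UR) := by
      rw [← hRH]
      unfold Fstar2
      module
    rw [hF]
    unfold Fstar2
    module

lemma alphaN_smul (γ : ℝ) (U : St2) (n : EuclideanSpace ℝ (Fin 2)) {c : ℝ} (hc : 0 < c) :
    alphaN γ (c • U) n = alphaN γ U n := by
  have hq : qvel (c • U) n = qvel U n := by
    simp only [qvel, Prod.smul_fst, Prod.smul_snd, real_inner_smul_left, smul_eq_mul]
    exact mul_div_mul_left _ _ hc.ne'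
  have hp : press2 γ (c • U) = c * press2 γ U := by
    simp only [press2, Prod.smul_fst, Prod.smul_snd, norm_smul, smul_eq_mul, Real.norm_eq_abs,
      mul_pow, sq_abs]
    have : c ^ 2 * ‖U.2.1‖ ^ 2 / (2 * (c * U.1)) = c * (‖U.2.1‖ ^ 2 / (2 * U.1)) := by
      rw [show c ^ 2 * ‖U.2.1‖ ^ 2 = c * (c * ‖U.2.1‖ ^ 2) by ring,
        show 2 * (c * U.1) = c * (2 * U.1) by ring, mul_div_mul_left _ _ hc.ne', mul_div_assoc]
    rw [this]
    ring
  have hs : sound2 γ (c • U) = sound2 γ U := by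
    rw [sound2, hp, sound2]
    congr 1
    rw [mul_left_comm]
    exact mul_div_mul_left _ _ hc.ne'
  rw [alphaN, alphaN, hq, hs]

/-- A body-force source is absorbed by a sufficiently large multiple of the state. -/
lemma smul_add_source_mem_closedAdmG2 {U : St2} (hU : U ∈ admG2)
    (b : EuclideanSpace ℝ (Fin 2)) {x : ℝ} (hx : ‖b‖ / √(2 * specE2 U) ≤ x) :
    x • U + (((0 : ℝ), U.1 • b, ⟪U.2.1, b⟫) : St2) ∈ closedAdmG2 := by
  have h1 := hU.1
  have he : 0 < 2 * specE2 U := mul_pos two_pos (div_pos hU.2 h1)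
  have hx0 : 0 ≤ x := le_trans (by positivity) hx
  have hb : ‖b‖ ^ 2 ≤ x ^ 2 * (2 * specE2 U) := by
    rw [← Real.sq_sqrt he.le, ← mul_pow]
    rw [div_le_iff₀ (Real.sqrt_pos.2 he)] at hx
    gcongr
  have hb' : U.1 ^ 2 * ‖b‖ ^ 2 ≤ x ^ 2 * (2 * U.1 * U.2.2 - ‖U.2.1‖ ^ 2) := by
    have hr : 2 * U.1 * U.2.2 - ‖U.2.1‖ ^ 2 = U.1 ^ 2 * (2 * specE2 U) := by
      rw [specE2]
      field_simp
    rw [hr]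
    nlinarith [mul_le_mul_of_nonneg_left hb (sq_nonneg U.1)]
  have hmom : ‖x • U.2.1 + U.1 • b‖ ^ 2 ≤ 2 * (x * U.1) * (x * U.2.2 + ⟪U.2.1, b⟫) := by
    rw [norm_add_sq_real, norm_smul, norm_smul, real_inner_smul_left, real_inner_smul_right,
      mul_pow, mul_pow, Real.norm_eq_abs, Real.norm_eq_abs, sq_abs, sq_abs]
    linarith
  refine ⟨?_, ?_, ?_⟩
  · change 0 ≤ x * U.1 + 0
    positivity
  · change 0 ≤ x * U.2.2 + ⟪U.2.1, b⟫
    rcases hx0.eq_or_lt with rfl | hx0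
    · have hb0 : b = 0 := by
        have : ‖b‖ ^ 2 ≤ 0 := by simpa using hb
        simpa using le_antisymm this (sq_nonneg _)
      simp [hb0]
    · exact nonneg_of_mul_nonneg_right ((sq_nonneg _).trans hmom) (by positivity)
  · change ‖x • U.2.1 + U.1 • b‖ ^ 2 ≤ 2 * (x * U.1 + 0) * (x * U.2.2 + ⟪U.2.1, b⟫)
    rwa [add_zero]

/-- Theorem 4.2: positivity of the first-order 2D well-balanced
DG scheme on a cell `K` with edge set `ι`. -/
theorem first_order_2D_WB_positivity (γ : ℝ) (hγ : 1 < γ)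
    (ι : Type*) [Fintype ι] [Nonempty ι]
    (len : ι → ℝ) (hlen : ∀ e, 0 < len e)
    (nE : ι → EuclideanSpace ℝ (Fin 2)) (hnE : ∀ e, ‖nE e‖ = 1)
    (UN : ι → St2) (hUN : ∀ e, UN e ∈ admG2)
    (peN : ι → ℝ) (hpeN : ∀ e, 0 < peN e)
    (areaK : ℝ) (hareaK : 0 < areaK)
    (UK : St2) (hUK : UK ∈ admG2)
    (peK : ℝ) (hpeK : 0 < peK) (ρeK : ℝ) (hρeK : 0 < ρeK)
    (Δt : ℝ) (hΔt : 0 < Δt)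
    (hcfl :
      Δt * (2 * (Finset.univ.sup' Finset.univ_nonempty
              (fun e => max (alphaN γ UK (nE e)) (alphaN γ (UN e) (nE e))) / areaK) *
            (∑ e, len e * ((peK + peN e) / 2) / peK)
          + ‖∑ e, (len e * ((peK + peN e) / 2)) • nE e‖ /
              (areaK * ρeK * Real.sqrt (2 * specE2 UK))) ≤ 1) :
    UK - (Δt / areaK) •
        (∑ e, len e •
          Fhllc2 γ (((peK + peN e) / 2 / peK) • UK)
            (((peK + peN e) / 2 / peN e) • UN e) (nE e))
      + Δt • ((1 / (areaK * ρeK)) •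
          (((0 : ℝ), UK.1 • (∑ e, (len e * ((peK + peN e) / 2)) • nE e),
            ⟪UK.2.1, ∑ e, (len e * ((peK + peN e) / 2)) • nE e⟫) : St2)) ∈ admG2 := by
  set A := Finset.univ.sup' Finset.univ_nonempty
    (fun e => max (alphaN γ UK (nE e)) (alphaN γ (UN e) (nE e)))
  set a := ∑ e, (len e * ((peK + peN e) / 2)) • nE e
  set F := fun e => Fhllc2 γ (((peK + peN e) / 2 / peK) • UK)
    (((peK + peN e) / 2 / peN e) • UN e) (nE e)
  have hA : ∀ e, max (alphaN γ UK (nE e)) (alphaN γ (UN e) (nE e)) ≤ A := fun e =>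
    Finset.le_sup' (fun e => max (alphaN γ UK (nE e)) (alphaN γ (UN e) (nE e)))
      (Finset.mem_univ e)
  have hedge : ∀ e, (2 * A) • ((peK + peN e) / 2 / peK) • UK - F e ∈ admG2 := by
    intro e
    have hN := hpeN e
    have cK : 0 < (peK + peN e) / 2 / peK := by positivity
    have cN : 0 < (peK + peN e) / 2 / peN e := by positivity
    refine smul_sub_Fhllc2_mem_admG2 hγ (smul_mem_admG2 hUK cK) (smul_mem_admG2 (hUN e) cN)
      (hnE e) ?_ ?_
    · rw [alphaN_smul _ _ _ cK]
      exact (le_max_left _ _).trans (hA e)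
    · rw [alphaN_smul _ _ _ cN]
      exact (le_max_right _ _).trans (hA e)
  have hsum : ∑ e, (Δt / areaK * len e) • ((2 * A) • ((peK + peN e) / 2 / peK) • UK - F e)
      ∈ admG2 :=
    Finset.sum_induction_nonempty _ (· ∈ admG2)
      (fun U V hU hV => add_mem_admG2 hU (admG2_subset_closedAdmG2 hV)) Finset.univ_nonempty
      fun e _ => smul_mem_admG2 (hedge e) (mul_pos (by positivity) (hlen e))
  have hsource := smul_add_source_mem_closedAdmG2 hUK ((Δt / (areaK * ρeK)) • a)
    (x := 1 - Δt * (2 * (A / areaK) * ∑ e, len e * ((peK + peN e) / 2) / peK)) (by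
      rw [norm_smul, Real.norm_of_nonneg (by positivity)]
      have hr : Δt / (areaK * ρeK) * ‖a‖ / √(2 * specE2 UK)
          = Δt * (‖a‖ / (areaK * ρeK * √(2 * specE2 UK))) := by
        simp only [div_eq_mul_inv, mul_inv]
        ring
      rw [hr]
      linarith)
  convert add_mem_admG2 hsum hsource using 1
  have hflux : ∑ e, (Δt / areaK * len e) • ((2 * A) • ((peK + peN e) / 2 / peK) • UK - F e)
      = (Δt * (2 * (A / areaK) * ∑ e, len e * ((peK + peN e) / 2) / peK)) • UK
        - (Δt / areaK) • ∑ e, len e • F e := by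
    simp only [smul_sub, Finset.sum_sub_distrib, Finset.mul_sum, Finset.sum_smul,
      Finset.smul_sum, smul_smul]
    congr 1
    refine Finset.sum_congr rfl fun e _ => ?_
    ring_nf
  have hsrc : (((0 : ℝ), UK.1 • (Δt / (areaK * ρeK)) • a,
        ⟪UK.2.1, (Δt / (areaK * ρeK)) • a⟫) : St2)
      = Δt • ((1 / (areaK * ρeK)) • (((0 : ℝ), UK.1 • a, ⟪UK.2.1, a⟫) : St2)) := by
    refine Prod.ext (by simp) (Prod.ext ?_ ?_)
    · simp only [Prod.smul_mk, smul_smul]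
      congr 1
      ring
    · simp only [Prod.smul_mk, real_inner_smul_right, smul_eq_mul]
      ring
  rw [hflux, hsrc]
  module
end
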